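/- Let U be a normal ultrafilter on a measurable cardinal δ. If λ is a limit ordinal whose cofinality computed in Ult(V,U) equals j_U(δ⁺), then there is an unbounded subset of λ that is fresh over Ult(V,U). -/

import Mathlib

noncomputable section

open Cardinal Set

namespace MU

/-- The type of ordinals below the initial ordinal of `δ`, serving as the underlying
set of the cardinal `δ` and indexing the ultrapower. -/
abbrev Idx (δ : Cardinal.{0}) : Type 1 := {o : Ordinal.{0} // o < δ.ord}

/-- A filter `F` is `κ`-complete (equivalently, `<κ`-closed): it is closed under
intersections of fewer than `κ` of its members. -/
def IsCComplete (κ : Cardinal.{0}) {X : Type*} (F : Filter X) : Prop :=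
  ∀ (ι : Type) (t : ι → Set X), #ι < κ → (∀ j, t j ∈ F) → (⋂ j, t j) ∈ F

/-- `U` is a normal ultrafilter on the measurable cardinal `δ`: `δ` is uncountable and
`U` is a `δ`-complete nonprincipal ultrafilter on `δ` such that every function that is
regressive on a set in `U` is constant on a set in `U`. -/
structure IsNormalUltrafilter (δ : Cardinal.{0}) (U : Ultrafilter (Idx δ)) : Prop where
  uncountable : ℵ₀ < δ
  complete : IsCComplete δ (U : Filter (Idx δ))
  nonprincipal : ∀ i : Idx δ, ({i} : Set (Idx δ)) ∉ U
  normal : ∀ f : Idx δ → Ordinal.{0}, { i : Idx δ | f i < i.1 } ∈ U →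
    ∃ c : Ordinal.{0}, { i : Idx δ | f i = c } ∈ U

variable {δ : Cardinal.{0}} {U : Ultrafilter (Idx δ)}

/-- The Łoś ordering on representatives of ordinals of the ultrapower `Ult(V,U)`. -/
def ultLT (U : Ultrafilter (Idx δ)) (f g : Idx δ → Ordinal.{0}) : Prop :=
  { i : Idx δ | f i < g i } ∈ U

theorem ultLT_wf (hU : IsNormalUltrafilter δ U) : WellFounded (ultLT U) := by
  haveI : IsIrrefl (Idx δ → Ordinal.{0}) (ultLT U) := by
    constructor
    intro f hf
    have h : ({ i : Idx δ | f i < f i } : Set (Idx δ)) = ∅ := by ext i; simp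
    rw [ultLT, h] at hf
    exact Filter.empty_notMem (U : Filter (Idx δ)) hf
  haveI : IsTrans (Idx δ → Ordinal.{0}) (ultLT U) := by
    constructor
    intro f g h hfg hgh
    have hsub : ({ i : Idx δ | f i < g i } ∩ { i : Idx δ | g i < h i } : Set (Idx δ)) ⊆
        { i : Idx δ | f i < h i } := fun i hi => show f i < h i from lt_trans hi.1 hi.2
    exact Filter.mem_of_superset (Filter.inter_mem hfg hgh) hsub
  haveI : IsStrictOrder (Idx δ → Ordinal.{0}) (ultLT U) := ⟨⟩
  rw [RelEmbedding.wellFounded_iff_isEmpty]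
  constructor
  intro g
  have hmem : ∀ n : ℕ, { i : Idx δ | g (n + 1) i < g n i } ∈ U :=
    fun n => g.map_rel_iff.2 (Nat.lt_succ_self n)
  have hint : (⋂ n : ℕ, { i : Idx δ | g (n + 1) i < g n i }) ∈ U := by
    refine hU.complete ℕ _ ?_ hmem
    rw [Cardinal.mk_nat]
    exact hU.uncountable
  obtain ⟨i, hi⟩ := Ultrafilter.nonempty_of_mem hint
  have hdesc : ∀ n : ℕ, (fun n => g n i) (n + 1) < (fun n => g n i) n :=
    fun n => Set.mem_iInter.1 hi n
  exact (RelEmbedding.wellFounded_iff_isEmpty.1 Ordinal.lt_wf).false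
    (RelEmbedding.natGT (fun n => g n i) hdesc)

/-- The ordinal represented by `f` in the transitive collapse of the ultrapower
`Ult(V,U)`, i.e. the rank of `f` in the (well-founded) Łoś ordering. -/
def ordRank (hU : IsNormalUltrafilter δ U) (f : Idx δ → Ordinal.{0}) : Ordinal.{0} :=
  sInf { o : Ordinal.{0} | Ordinal.lift.{1} o = ((ultLT_wf hU).apply f).rank }

/-- The image of an ordinal under the ultrapower embedding `j_U : V → Ult(V,U)`. -/
def jU (hU : IsNormalUltrafilter δ U) (o : Ordinal.{0}) : Ordinal.{0} :=
  ordRank hU fun _ => o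

/-- The set of ordinals that is the transitive collapse of the element of the
ultrapower `Ult(V,U)` represented by the function `f`. -/
def ultSet (hU : IsNormalUltrafilter δ U) (f : Idx δ → Set Ordinal.{0}) :
    Set Ordinal.{0} :=
  { o : Ordinal.{0} |
    ∃ g : Idx δ → Ordinal.{0}, { i : Idx δ | g i ∈ f i } ∈ U ∧ ordRank hU g = o }

/-- A set of ordinals is (the transitive collapse of) an element of the ultrapower
`Ult(V,U)`. -/
def InUlt (hU : IsNormalUltrafilter δ U) (A : Set Ordinal.{0}) : Prop :=
  ∃ f : Idx δ → Set Ordinal.{0}, (∀ i, BddAbove (f i)) ∧ A = ultSet hU f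

/-- The least upper bound of a set of ordinals. -/
def lub (A : Set Ordinal.{0}) : Ordinal.{0} :=
  sSup ((fun o => o + 1) '' A)

/-- Hamkins: a set `A` of ordinals is fresh over `Ult(V,U)` if `A ∉ Ult(V,U)` but
`A ∩ α ∈ Ult(V,U)` for every `α < lub A`. -/
def Fresh (hU : IsNormalUltrafilter δ U) (A : Set Ordinal.{0}) : Prop :=
  ¬ InUlt hU A ∧ ∀ α < lub A, InUlt hU (A ∩ Iio α)

/-- `A` is an unbounded subset of the ordinal `l`. -/
def UnbSub (A : Set Ordinal.{0}) (l : Ordinal.{0}) : Prop :=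
  A ⊆ Iio l ∧ ∀ b < l, ∃ a ∈ A, b ≤ a

/-- `A` is a closed subset of the ordinal `l`: it contains the suprema of all of its
nonempty subsets that are bounded below `l`. -/
def ClosedIn (A : Set Ordinal.{0}) (l : Ordinal.{0}) : Prop :=
  ∀ S ⊆ A, S.Nonempty → sSup S < l → sSup S ∈ A

/-- The set of limit points of a set of ordinals. -/
def limitPts (A : Set Ordinal.{0}) : Set Ordinal.{0} :=
  { b : Ordinal.{0} | (A ∩ Iio b).Nonempty ∧ sSup (A ∩ Iio b) = b }

/-- `S` is a stationary subset of the ordinal `l`. -/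
def StationaryIn (S : Set Ordinal.{0}) (l : Ordinal.{0}) : Prop :=
  S ⊆ Iio l ∧ ∀ D : Set Ordinal.{0}, ClosedIn D l → UnbSub D l → (S ∩ D).Nonempty

/-- The order type of the set of ordinals `C` is at most `o`. -/
def otpLE (C : Set Ordinal.{0}) (o : Ordinal.{0}) : Prop :=
  ∃ g : Ordinal.{0} → Ordinal.{0}, (∀ a ∈ C, g a < o) ∧
    ∀ a ∈ C, ∀ b ∈ C, a < b → g a < g b

/-- The order type of the set of ordinals `C` is (strictly) less than `o`. -/
def otpLT (C : Set Ordinal.{0}) (o : Ordinal.{0}) : Prop :=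
  ∃ o' < o, otpLE C o'

/-- `C` is a `□(Θ)`-sequence, where `Θ` is (the initial ordinal of) an uncountable
regular cardinal. -/
structure IsSquareSeq (Θ : Ordinal.{0}) (C : Ordinal.{0} → Set Ordinal.{0}) : Prop where
  closed : ∀ γ < Θ, Order.IsSuccLimit γ → ClosedIn (C γ) γ
  unbounded : ∀ γ < Θ, Order.IsSuccLimit γ → UnbSub (C γ) γ
  coherent : ∀ γ < Θ, Order.IsSuccLimit γ → ∀ β ∈ limitPts (C γ), β < γ → C β = C γ ∩ Iio β
  nontrivial : ¬ ∃ D : Set Ordinal.{0}, ClosedIn D Θ ∧ UnbSub D Θ ∧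
    ∀ γ ∈ limitPts D, γ < Θ → D ∩ Iio γ = C γ

/-- `C` is a `□_κ`-sequence: a `□(κ⁺)`-sequence all of whose clubs have order type
at most `κ`. -/
def IsSquareKappaSeq (κ : Cardinal.{0}) (C : Ordinal.{0} → Set Ordinal.{0}) : Prop :=
  IsSquareSeq (Order.succ κ).ord C ∧
    ∀ γ < (Order.succ κ).ord, Order.IsSuccLimit γ → otpLE (C γ) κ.ord

/-- `κ` is a weakly compact cardinal: `κ` is uncountable and every coloring of the
pairs of ordinals below `κ` in fewer than `κ` colors has a homogeneous set of size `κ`. -/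
def IsWeaklyCompact (κ : Cardinal.{0}) : Prop :=
  ℵ₀ < κ ∧ ∀ (ν : Type) (c : Ordinal.{0} → Ordinal.{0} → ν), #ν < κ →
    ∃ H : Set Ordinal.{0}, H ⊆ Iio κ.ord ∧ Cardinal.lift.{1} κ ≤ #H ∧
      ∀ a ∈ H, ∀ b ∈ H, ∀ a' ∈ H, ∀ b' ∈ H, a < b → a' < b' → c a b = c a' b'

/-- `κ` is a strongly compact cardinal: every `κ`-complete filter (on any set)
extends to a `κ`-complete ultrafilter. -/
def IsStronglyCompact (κ : Cardinal.{0}) : Prop :=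
  ∀ (X : Type) (F : Filter X), IsCComplete κ F →
    ∃ G : Ultrafilter X, F ≤ (G : Filter X) ∧ IsCComplete κ (G : Filter X)

/-- `κ` is a singular cardinal. -/
def IsSingular (κ : Cardinal.{0}) : Prop :=
  ℵ₀ ≤ κ ∧ κ.ord.cof < κ

/-- The cofinality of the ordinal `l` as computed inside the ultrapower `Ult(V,U)`
(as an ordinal, i.e. the image of the ultrapower's cofinality under the transitive
collapse). -/
def cofUlt (hU : IsNormalUltrafilter δ U) (l : Ordinal.{0}) : Ordinal.{0} :=
  sInf { c : Ordinal.{0} | ∃ f : Idx δ → Ordinal.{0},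
    ordRank hU f = l ∧ ordRank hU (fun i => ((f i).cof).ord) = c }

/-- The ordinal `o` is (the transitive collapse of) a cardinal of the ultrapower
`Ult(V,U)`. -/
def CardInUlt (hU : IsNormalUltrafilter δ U) (o : Ordinal.{0}) : Prop :=
  ∃ f : Idx δ → Ordinal.{0}, ordRank hU f = o ∧
    { i : Idx δ | ((f i).card).ord = f i } ∈ U

/-- The ordinal `o` is (the transitive collapse of) a regular cardinal of the
ultrapower `Ult(V,U)`. -/
def RegularInUlt (hU : IsNormalUltrafilter δ U) (o : Ordinal.{0}) : Prop :=
  ∃ f : Idx δ → Ordinal.{0}, ordRank hU f = o ∧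
    { i : Idx δ | ((f i).card).IsRegular ∧ ((f i).card).ord = f i } ∈ U

/-- The cardinal successor of the ordinal `o` as computed inside the ultrapower
`Ult(V,U)`: the least ordinal above `o` that is a cardinal in `Ult(V,U)`. -/
def succInUlt (hU : IsNormalUltrafilter δ U) (o : Ordinal.{0}) : Ordinal.{0} :=
  sInf { c : Ordinal.{0} | o < c ∧ CardInUlt hU c }

/-- The cardinality of a set of ordinals, as an (initial) ordinal: the least ordinal
`o` such that `s` is the image of a function defined on the ordinals below `o`. -/
def setCardOrd (s : Set Ordinal.{0}) : Ordinal.{0} :=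
  sInf { o : Ordinal.{0} | ∃ g : Ordinal.{0} → Ordinal.{0}, s ⊆ g '' Iio o }

theorem lift_ordRank (hU : IsNormalUltrafilter δ U) (f : Idx δ → Ordinal.{0}) :
    Ordinal.lift.{1} (ordRank hU f) = ((ultLT_wf hU).apply f).rank := by
  have : IsWellFounded _ (ultLT U) := ⟨ultLT_wf hU⟩
  have rank_congr (g g' : Idx δ → Ordinal.{0}) (hg : ∀ᶠ i in (U : Filter (Idx δ)), g i = g' i) :
      IsWellFounded.rank (ultLT U) g = IsWellFounded.rank (ultLT U) g' := by
    have hiff (b : Idx δ → Ordinal.{0}) : ultLT U b g ↔ ultLT U b g' :=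
      Filter.eventually_congr (hg.mono fun i hi => by rw [hi])
    have hset : (ultLT U · g) = (ultLT U · g') := funext fun b => propext (hiff b)
    rw [IsWellFounded.rank_eq, IsWellFounded.rank_eq (ultLT U) g']
    exact congrArg (fun s : (Idx δ → Ordinal.{0}) → Prop =>
      ⨆ b : { b // s b }, Order.succ (IsWellFounded.rank (ultLT U) b.1)) hset
  have hsmall : Small.{0} (Iio (IsWellFounded.rank (ultLT U) f)) := by
    have : Small.{0} (Idx δ) := inferInstanceAs (Small.{0} (Iio δ.ord))
    let φ : (∀ i : Idx δ, Iio (f i + 1)) → Ordinal.{1} :=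
      fun g => IsWellFounded.rank (ultLT U) fun i => (g i).1
    refine small_subset (s := range φ) fun o ho => ?_
    obtain ⟨g, rfl⟩ := IsWellFounded.mem_range_rank_of_le (le_of_lt ho)
    refine ⟨fun i => ⟨min (g i) (f i), mem_Iio.2 (Order.lt_add_one_iff.2 (min_le_right _ _))⟩, ?_⟩
    have hgf : ∀ᶠ i in (U : Filter (Idx δ)), g i ≤ f i := by
      by_contra hc
      have hlt : ultLT U f g := (Ultrafilter.eventually_not.2 hc).mono fun i hi => not_le.1 hi
      exact (IsWellFounded.rank_lt_of_rel hlt).not_gt ho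
    exact rank_congr _ _ (hgf.mono fun i hi => min_eq_left hi)
  have hmem : ((ultLT_wf hU).apply f).rank ∈ range Ordinal.lift.{1, 0} := by
    have hcard := Cardinal.lift_mk_eq'.2
      ⟨equivShrink.{0} (Iio (IsWellFounded.rank (ultLT U) f))⟩
    rw [Cardinal.mk_Iio_ordinal, Cardinal.lift_lift] at hcard
    refine Ordinal.mem_range_lift_of_card_le
      (a := #(Shrink.{0} (Iio (IsWellFounded.rank (ultLT U) f)))) (le_of_eq ?_)
    rw [← Cardinal.lift_inj.{1, 2}, Cardinal.lift_lift]
    exact hcard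
  exact csInf_mem (s := { o | Ordinal.lift.{1} o = ((ultLT_wf hU).apply f).rank }) hmem

theorem ordRank_lt_iff (hU : IsNormalUltrafilter δ U) {f g : Idx δ → Ordinal.{0}} :
    ordRank hU f < ordRank hU g ↔ ∀ᶠ i in (U : Filter (Idx δ)), f i < g i := by
  have hlt {f g : Idx δ → Ordinal.{0}} (h : ultLT U f g) : ordRank hU f < ordRank hU g := by
    rw [← Ordinal.lift_lt.{1, 0}, lift_ordRank, lift_ordRank]
    exact Acc.rank_lt_of_rel _ h
  refine ⟨fun h => ?_, hlt⟩
  by_contra hc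
  have hle : ∀ᶠ i in (U : Filter (Idx δ)), g i ≤ f i :=
    (Ultrafilter.eventually_not.2 hc).mono fun i hi => not_lt.1 hi
  refine h.not_ge ?_
  rw [← Ordinal.lift_le.{1, 0}, lift_ordRank, lift_ordRank, Acc.rank_eq, Ordinal.iSup_le_iff]
  rintro ⟨b, hb⟩
  refine Order.succ_le_of_lt (Acc.rank_lt_of_rel _ (?_ : ultLT U b f))
  exact Filter.Eventually.mp hb (hle.mono fun i hi hbi => hbi.trans_le hi)

theorem ordRank_le_iff (hU : IsNormalUltrafilter δ U) {f g : Idx δ → Ordinal.{0}} :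
    ordRank hU f ≤ ordRank hU g ↔ ∀ᶠ i in (U : Filter (Idx δ)), f i ≤ g i := by
  rw [← not_lt, ordRank_lt_iff, ← Ultrafilter.eventually_not]
  simp only [not_lt]

theorem ordRank_eq_iff (hU : IsNormalUltrafilter δ U) {f g : Idx δ → Ordinal.{0}} :
    ordRank hU f = ordRank hU g ↔ ∀ᶠ i in (U : Filter (Idx δ)), f i = g i := by
  rw [le_antisymm_iff, ordRank_le_iff, ordRank_le_iff, ← Filter.eventually_and]
  simp only [← le_antisymm_iff]

theorem ordRank_surjective (hU : IsNormalUltrafilter δ U) : Function.Surjective (ordRank hU) := by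
  intro o
  have hmono : StrictMono (jU hU) := fun a b hab =>
    (ordRank_lt_iff hU).2 (Filter.Eventually.of_forall fun _ => hab)
  have hle : Ordinal.lift.{1} o ≤ ((ultLT_wf hU).apply fun _ => o).rank := by
    rw [← lift_ordRank, Ordinal.lift_le]
    exact hmono.le_apply
  obtain ⟨g, hg, hgo⟩ := Acc.mem_range_rank_of_le _ hle
  exact ⟨g, Ordinal.lift_inj.{1, 0}.1 ((lift_ordRank hU g).trans hgo)⟩

/-- Every final segment of `δ` is in a normal ultrafilter on `δ`. -/
theorem eventually_gt (hU : IsNormalUltrafilter δ U) {o : Ordinal.{0}} (ho : o < δ.ord) :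
    ∀ᶠ i in (U : Filter (Idx δ)), o < i.1 := by
  have ho' : o + 1 < δ.ord := (Cardinal.isSuccLimit_ord hU.uncountable.le).add_one_lt ho
  have hmem := hU.complete (o + 1).ToType
    (fun j => {⟨(Ordinal.ToType.toOrd j).1, (Ordinal.ToType.toOrd j).2.trans ho'⟩}ᶜ)
    (by rw [Cardinal.mk_toType]; exact Cardinal.lt_ord.1 ho')
    (fun j => Ultrafilter.compl_mem_iff_notMem.2 (hU.nonprincipal _))
  filter_upwards [hmem] with i hi
  by_contra hc
  refine mem_iInter.1 hi (Ordinal.ToType.mk ⟨i.1, Order.lt_add_one_iff.2 (not_lt.1 hc)⟩) ?_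
  simp [Ordinal.ToType.toOrd]

/-- A family of ordinals below `δ⁺` indexed by `δ` is bounded below `δ⁺`. -/
theorem exists_bound_lt_succ (hδ : ℵ₀ ≤ δ) (s : Set (Idx δ)) (g : Idx δ → Ordinal.{0})
    (hg : ∀ i ∈ s, g i < (Order.succ δ).ord) :
    ∃ b < (Order.succ δ).ord, ∀ i ∈ s, g i < b := by
  have hsmall : #s < (Ordinal.lift.{1} (Order.succ δ).ord).cof := by
    rw [← Ordinal.lift_cof, (Cardinal.isRegular_succ hδ).cof_ord]
    refine (Cardinal.mk_set_le s).trans_lt ?_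
    have : #(Idx δ) = Cardinal.lift.{1} δ := by
      exact (Cardinal.mk_Iio_ordinal δ.ord).trans (by rw [Cardinal.card_ord])
    rw [this, Cardinal.lift_lt]
    exact Order.lt_succ δ
  refine ⟨⨆ i : s, g i + 1,
    Ordinal.lift_iSup_add_one_lt_of_lt_cof (by simpa using hsmall) fun i => hg i i.2, ?_⟩
  intro i hi
  have : Small.{0} (Idx δ) := inferInstanceAs (Small.{0} (Iio δ.ord))
  exact (Order.lt_add_one_iff.2 le_rfl).trans_le
    (Ordinal.le_iSup (fun i : s => g i + 1) ⟨i, hi⟩)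

theorem exists_injOn_Iio (η : Ordinal.{0}) (hη : η < (Order.succ δ).ord) :
    ∃ e : Ordinal.{0} → Ordinal.{0}, InjOn e (Iio η) ∧ ∀ ξ < η, e ξ < δ.ord := by
  have hcard : #(Iio η) ≤ #(Iio δ.ord) := by
    rw [Cardinal.mk_Iio_ordinal, Cardinal.mk_Iio_ordinal, Cardinal.lift_le, Cardinal.card_ord]
    exact Order.lt_succ_iff.1 (Cardinal.lt_ord.1 hη)
  obtain ⟨e⟩ := hcard
  refine ⟨fun ξ => if h : ξ ∈ Iio η then e ⟨ξ, h⟩ else 0, fun a ha b hb hab => ?_, fun ξ hξ => ?_⟩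
  · simp only [dif_pos ha, dif_pos hb] at hab
    exact congrArg Subtype.val (e.injective (Subtype.val_injective hab))
  · simp only [dif_pos (mem_Iio.2 hξ)]
    exact (e ⟨ξ, hξ⟩).2

theorem exists_strictMonoOn_cofinal {o κ : Ordinal.{0}} (h : o.cof.ord = κ) :
    ∃ c : Ordinal.{0} → Ordinal.{0}, StrictMonoOn c (Iio κ) ∧ (∀ ξ < κ, c ξ < o) ∧
      ∀ b < o, ∃ ξ < κ, b ≤ c ξ := by
  obtain ⟨c, hc⟩ := Ordinal.exists_isFundamentalSeq h
  refine ⟨fun ξ => if h : ξ ∈ Iio κ then c ⟨ξ, h⟩ else 0, fun a ha b hb hab => ?_, fun ξ hξ => ?_,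
    fun b hb => ?_⟩
  · simp only [dif_pos ha, dif_pos hb]
    exact hc.strictMono (show (⟨a, ha⟩ : Iio κ) < ⟨b, hb⟩ from hab)
  · simp only [dif_pos (mem_Iio.2 hξ)]
    exact (c ⟨ξ, hξ⟩).2
  · obtain ⟨_, ⟨ξ, rfl⟩, hξ⟩ := hc.isCofinal_range ⟨b, hb⟩
    refine ⟨ξ, ξ.2, ?_⟩
    simp only [dif_pos ξ.2]
    exact hξ

/-- If `λ` is a limit ordinal whose cofinality computed in `Ult(V,U)` equals
`j_U(δ⁺)`, then there is an unbounded subset of `λ` that is fresh over `Ult(V,U)`. -/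
theorem stmt4 (δ : Cardinal.{0}) (U : Ultrafilter (Idx δ)) (hU : IsNormalUltrafilter δ U)
    (l : Ordinal.{0}) (hl : Order.IsSuccLimit l)
    (h : cofUlt hU l = jU hU (Order.succ δ).ord) :
    ∃ A : Set Ordinal.{0}, UnbSub A l ∧ Fresh hU A := by
  have hδ : ℵ₀ ≤ δ := hU.uncountable.le
  set κ := (Order.succ δ).ord with hκ
  have hκlim : Order.IsSuccLimit κ :=
    Cardinal.isSuccLimit_ord (hδ.trans (Order.le_succ δ))
  obtain ⟨f, hf, hcof⟩ : ∃ f : Idx δ → Ordinal.{0}, ordRank hU f = l ∧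
      ∀ i, ((f i).cof).ord = κ := by
    have hne : { c : Ordinal.{0} | ∃ f : Idx δ → Ordinal.{0},
        ordRank hU f = l ∧ ordRank hU (fun i => ((f i).cof).ord) = c }.Nonempty := by
      obtain ⟨f, hf⟩ := ordRank_surjective hU l
      exact ⟨_, f, hf, rfl⟩
    obtain ⟨f, hf, hfc⟩ := csInf_mem hne
    have hfκ := (ordRank_eq_iff hU).1 (hfc.trans h)
    classical
    refine ⟨fun i => if ((f i).cof).ord = κ then f i else κ, ?_, fun i => ?_⟩
    · rw [← hf]
      exact (ordRank_eq_iff hU).2 (hfκ.mono fun i hi => if_pos hi)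
    · dsimp only
      split_ifs with hi
      · exact hi
      · rw [hκ, (Cardinal.isRegular_succ hδ).cof_ord]
  choose c hcmono hclt hccof using fun i => exists_strictMonoOn_cofinal (hcof i)
  let a : Ordinal.{0} → Ordinal.{0} := fun ξ => ordRank hU fun i => c i ξ
  have ha_mono : StrictMonoOn a (Iio κ) := fun ξ hξ η hη hξη =>
    (ordRank_lt_iff hU).2 (Filter.Eventually.of_forall fun i => hcmono i hξ hη hξη)
  have ha_lt (ξ) (hξ : ξ < κ) : a ξ < l := by
    rw [← hf]
    exact (ordRank_lt_iff hU).2 (Filter.Eventually.of_forall fun i => hclt i ξ hξ)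
  have ha_cof (b) (hb : b < l) : ∃ ξ < κ, b ≤ a ξ := by
    obtain ⟨g, rfl⟩ := ordRank_surjective hU b
    rw [← hf, ordRank_lt_iff] at hb
    choose! ξ hξκ hξ using fun i (hi : g i < f i) => hccof i (g i) hi
    obtain ⟨η, hη, hηb⟩ := exists_bound_lt_succ hδ { i | g i < f i } ξ hξκ
    refine ⟨η, hη, (ordRank_le_iff hU).2 (hb.mono fun i hi => ?_)⟩
    exact (hξ i hi).trans (hcmono i (hξκ i hi) hη (hηb i hi)).le
  refine ⟨a '' Iio κ, ⟨?_, ?_⟩, ?_, ?_⟩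
  · rintro _ ⟨ξ, hξ, rfl⟩
    exact ha_lt ξ hξ
  · intro b hb
    obtain ⟨ξ, hξ, hbξ⟩ := ha_cof b hb
    exact ⟨_, ⟨ξ, hξ, rfl⟩, hbξ⟩
  · rintro ⟨S, -, hS⟩
    have hunb : ∀ᶠ i in (U : Filter (Idx δ)), ∀ b < κ, ∃ x < κ, b ≤ x ∧ c i x ∈ S i := by
      by_contra hc
      rw [← Ultrafilter.eventually_not] at hc
      push Not at hc
      choose! b hbκ hb using
        fun i (hi : ∃ b < κ, ∀ x < κ, b ≤ x → c i x ∉ S i) => hi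
      obtain ⟨η, hη, hηb⟩ := exists_bound_lt_succ hδ _ b hbκ
      have hmem : a η ∈ ultSet hU S := hS ▸ mem_image_of_mem a hη
      obtain ⟨g, hg, hga⟩ := hmem
      obtain ⟨i, hi, hgi, hgc⟩ :=
        (hc.and (Filter.Eventually.and hg ((ordRank_eq_iff hU).1 hga))).exists
      exact hb i hi η hη (hηb i hi).le (hgc ▸ hgi)
    set good : Set (Idx δ) := { i | ∀ b < κ, ∃ x < κ, b ≤ x ∧ c i x ∈ S i } with hgood
    obtain ⟨t, ht⟩ : ∃ t : Idx δ → Ordinal.{0}, ∀ i ∈ good,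
        t i < κ ∧ c i (t i) ∈ S i ∧ ∀ k < i, k ∈ good → t k < t i := by
      have hstep (i : Idx δ) (t : ∀ k < i, Ordinal.{0}) : ∃ x : Ordinal.{0}, i ∈ good →
          (∀ k (hk : k < i), k ∈ good → t k hk < κ) →
          x < κ ∧ c i x ∈ S i ∧ ∀ k (hk : k < i), k ∈ good → t k hk < x := by
        by_cases hi : i ∈ good
        · by_cases htκ : ∀ k (hk : k < i), k ∈ good → t k hk < κ
          · classical
            obtain ⟨η, hη, hηb⟩ := exists_bound_lt_succ hδ { k | k < i ∧ k ∈ good }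
              (fun k => if hk : k < i then t k hk else 0)
              (fun k hk => by simpa [hk.1] using htκ k hk.1 hk.2)
            obtain ⟨x, hxκ, hηx, hxS⟩ := hi η hη
            refine ⟨x, fun _ _ => ⟨hxκ, hxS, fun k hk hkg => ?_⟩⟩
            have := hηb k ⟨hk, hkg⟩
            simp only [hk, dif_pos] at this
            exact this.trans_le hηx
          · exact ⟨0, fun _ h => absurd h htκ⟩
        · exact ⟨0, fun h => absurd h hi⟩
      choose F hF using hstep
      let t : Idx δ → Ordinal.{0} := wellFounded_lt.fix F
      have hteq (i) : t i = F i fun k _ => t k := wellFounded_lt.fix_eq F i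
      have htκ (i) : i ∈ good → t i < κ := by
        induction i using WellFoundedLT.induction with
        | ind i ih =>
          intro hi
          rw [hteq]
          exact (hF i _ hi fun k hk hkg => ih k hk hkg).1
      refine ⟨t, fun i hi => ?_⟩
      have := hF i (fun k _ => t k) hi fun k _ hkg => htκ k hkg
      rwa [← hteq] at this
    have hmem : ordRank hU (fun i => c i (t i)) ∈ a '' Iio κ := by
      rw [hS]
      exact ⟨_, Filter.Eventually.mono hunb fun i hi => (ht i hi).2.1, rfl⟩
    obtain ⟨ξ, hξ, hξt⟩ := hmem
    have hconst : ∀ᶠ i in (U : Filter (Idx δ)), i ∈ good ∧ t i = ξ :=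
      (Filter.Eventually.and hunb ((ordRank_eq_iff hU).1 hξt)).mono fun i hi =>
        ⟨hi.1, (hcmono i).injOn (ht i hi.1).1 hξ hi.2.symm⟩
    obtain ⟨i, hi, hti⟩ := hconst.exists
    obtain ⟨k, ⟨hk, htk⟩, hik⟩ := (hconst.and (eventually_gt hU i.2)).exists
    exact ((ht k hk).2.2 i hik hi).ne (hti.trans htk.symm)
  · intro α hα
    obtain ⟨_, ⟨_, ⟨η, hη, rfl⟩, rfl⟩, hαη⟩ := exists_lt_of_lt_csSup
      (((show (Iio κ).Nonempty from ⟨0, hκlim.bot_lt⟩).image a).image _) hα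
    rw [Order.lt_add_one_iff] at hαη
    obtain ⟨g, rfl⟩ := ordRank_surjective hU α
    obtain ⟨e, heinj, helt⟩ := exists_injOn_Iio η hη
    refine ⟨fun i => (c i '' { ξ | ξ < η ∧ e ξ < i.1 }) ∩ Iio (g i),
      fun i => ⟨g i, fun x hx => hx.2.le⟩, Subset.antisymm ?_ ?_⟩
    · rintro _ ⟨⟨ξ, hξ, rfl⟩, hξα⟩
      have hξη : ξ < η := (ha_mono.lt_iff_lt hξ hη).1 (hξα.trans_le hαη)
      refine ⟨_, ?_, rfl⟩
      filter_upwards [(ordRank_lt_iff hU).1 hξα, eventually_gt hU (helt ξ hξη)] with i hig hie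
      exact ⟨⟨ξ, ⟨hξη, hie⟩, rfl⟩, hig⟩
    · rintro _ ⟨h, hh, rfl⟩
      choose! ξ hξ hξh using fun i (hi : h i ∈ c i '' { ξ | ξ < η ∧ e ξ < i.1 }) => hi
      obtain ⟨γ, hγ⟩ := hU.normal (fun i => e (ξ i))
        (Filter.mem_of_superset hh fun i hi => (hξ i hi.1).2)
      have hall := Filter.Eventually.and hh hγ
      obtain ⟨k, hk, hkγ⟩ := hall.exists
      have hha : ∀ᶠ i in (U : Filter (Idx δ)), c i (ξ k) = h i := hall.mono fun i hi => by
        rw [← hξh i hi.1.1, heinj (hξ k hk.1).1 (hξ i hi.1.1).1 (hkγ.trans hi.2.symm)]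
      exact ⟨⟨ξ k, (hξ k hk.1).1.trans hη, (ordRank_eq_iff hU).2 hha⟩,
        (ordRank_lt_iff hU).2 (Filter.Eventually.mono hh fun i hi => hi.2)⟩

end MU
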